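/- Let G be a group with word length ∥·∥ and word metric d coming from a symmetric generating set (possibly infinite), suppose the word metric is δ-hyperbolic (every geodesic triangle is δ-slim), and suppose G has conjugacy bounds with constant K ≥ 1. Let r = w s w⁻¹ where w has minimal word length among all elements conjugating s to r (i.e. ∥w∥ ≤ ∥v∥ whenever r = v s v⁻¹). Then for every geodesic g₀ = 1, g₁, …, g_N = r from the identity to r, both w and ws lie within distance L₁ = 2K(∥s∥ + 2δ) + 2 of the set {g₀, …, g_N}; in particular the path corresponding to the word w s w⁻¹ from 1 to r lies in a neighbourhood of any geodesic from 1 to r whose radius depends only on ∥s∥, δ and K, and not on ∥r∥. -/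

import Mathlib

/-- The word length of `g` with respect to a generating set `S`: the least `n` such that
`g` is a product of `n` elements of `S`. -/
noncomputable def wordLength {G : Type*} [Group G] (S : Set G) (g : G) : ℕ :=
  sInf {n : ℕ | ∃ l : List G, (∀ x ∈ l, x ∈ S) ∧ l.length = n ∧ l.prod = g}

/-- The word metric `d(x,y) = ∥x⁻¹ y∥` associated to the generating set `S`. -/
noncomputable def wordDist {G : Type*} [Group G] (S : Set G) (x y : G) : ℕ :=
  wordLength S (x⁻¹ * y)

/-- A geodesic in the (integer-valued) word metric: a finite sequence
`γ 0, γ 1, …, γ N` with `d(γ i, γ j) = |i - j|` for all `i, j`. -/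
def IsWordGeodesic {G : Type*} [Group G] (S : Set G) (N : ℕ) (γ : Fin (N + 1) → G) : Prop :=
  ∀ i j : Fin (N + 1), (wordDist S (γ i) (γ j) : ℤ) = |(i : ℤ) - (j : ℤ)|

/-- The word metric is `δ`-hyperbolic (`δ`-slim triangles): for any triangle of geodesics,
each side lies in the closed `δ`-neighbourhood of the union of the other two.  (Since the
quantification is over all vertices and all geodesics, and reversal of a geodesic is a
geodesic, it suffices to require this for the side from `x` to `z`.) -/
def WordSlimTriangles {G : Type*} [Group G] (S : Set G) (δ : ℝ) : Prop :=
  ∀ (x y z : G) (N₁ N₂ N₃ : ℕ)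
    (γ₁ : Fin (N₁ + 1) → G) (γ₂ : Fin (N₂ + 1) → G) (γ₃ : Fin (N₃ + 1) → G),
    IsWordGeodesic S N₁ γ₁ → IsWordGeodesic S N₂ γ₂ → IsWordGeodesic S N₃ γ₃ →
    γ₁ 0 = x → γ₁ (Fin.last N₁) = y →
    γ₂ 0 = y → γ₂ (Fin.last N₂) = z →
    γ₃ 0 = x → γ₃ (Fin.last N₃) = z →
    ∀ i : Fin (N₃ + 1), ∃ p ∈ Set.range γ₁ ∪ Set.range γ₂, (wordDist S (γ₃ i) p : ℝ) ≤ δ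

/-- `G` (with word length `∥⬝∥`) has conjugacy bounds with constant `K`: whenever `a` and
`b` are conjugate there is `v` with `a = v b v⁻¹` and `∥v∥ ≤ K (∥a∥ + ∥b∥)`. -/
def HasConjugacyBounds {G : Type*} [Group G] (S : Set G) (K : ℝ) : Prop :=
  ∀ a b : G, IsConj a b →
    ∃ v : G, a = v * b * v⁻¹ ∧
      (wordLength S v : ℝ) ≤ K * ((wordLength S a : ℝ) + (wordLength S b : ℝ))

section WordMetric

variable {G : Type*} [Group G] {S : Set G}

theorem exists_list_of_closure_eq_top (hSsymm : ∀ s ∈ S, s⁻¹ ∈ S)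
    (hSgen : Subgroup.closure S = ⊤) (g : G) :
    ∃ l : List G, (∀ x ∈ l, x ∈ S) ∧ l.prod = g := by
  have hg : g ∈ (Subgroup.closure S).toSubmonoid := by simp [hSgen]
  rw [Subgroup.closure_toSubmonoid] at hg
  obtain ⟨l, hl, hprod⟩ := Submonoid.exists_list_of_mem_closure hg
  exact ⟨l, fun x hx => (hl x hx).elim id fun h => by simpa using hSsymm _ h, hprod⟩

theorem exists_list_length_eq_wordLength (hSsymm : ∀ s ∈ S, s⁻¹ ∈ S)
    (hSgen : Subgroup.closure S = ⊤) (g : G) :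
    ∃ l : List G, (∀ x ∈ l, x ∈ S) ∧ l.length = wordLength S g ∧ l.prod = g := by
  obtain ⟨l, hl, hprod⟩ := exists_list_of_closure_eq_top hSsymm hSgen g
  exact Nat.sInf_mem
    (s := {n : ℕ | ∃ l : List G, (∀ x ∈ l, x ∈ S) ∧ l.length = n ∧ l.prod = g})
    ⟨l.length, l, hl, rfl, hprod⟩

theorem wordLength_prod_le (l : List G) (hl : ∀ x ∈ l, x ∈ S) :
    wordLength S l.prod ≤ l.length :=
  Nat.sInf_le ⟨l, hl, rfl, rfl⟩

theorem wordLength_one : wordLength S (1 : G) = 0 :=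
  Nat.le_zero.1 (wordLength_prod_le [] (by simp))

theorem wordLength_mul_le (hSsymm : ∀ s ∈ S, s⁻¹ ∈ S)
    (hSgen : Subgroup.closure S = ⊤) (a b : G) :
    wordLength S (a * b) ≤ wordLength S a + wordLength S b := by
  obtain ⟨l, hl, hlen, rfl⟩ := exists_list_length_eq_wordLength hSsymm hSgen a
  obtain ⟨l', hl', hlen', rfl⟩ := exists_list_length_eq_wordLength hSsymm hSgen b
  rw [← hlen, ← hlen', ← List.prod_append, ← List.length_append]
  exact wordLength_prod_le _ fun x hx => (List.mem_append.1 hx).elim (hl x) (hl' x)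

theorem wordLength_inv_le (hSsymm : ∀ s ∈ S, s⁻¹ ∈ S)
    (hSgen : Subgroup.closure S = ⊤) (a : G) :
    wordLength S a⁻¹ ≤ wordLength S a := by
  obtain ⟨l, hl, hlen, rfl⟩ := exists_list_length_eq_wordLength hSsymm hSgen a
  rw [← hlen, List.prod_inv_reverse]
  refine (wordLength_prod_le _ ?_).trans_eq (by simp)
  intro x hx
  obtain ⟨y, hy, rfl⟩ := List.mem_map.1 (List.mem_reverse.1 hx)
  exact hSsymm y (hl y hy)

theorem wordLength_inv (hSsymm : ∀ s ∈ S, s⁻¹ ∈ S)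
    (hSgen : Subgroup.closure S = ⊤) (a : G) :
    wordLength S a⁻¹ = wordLength S a :=
  (wordLength_inv_le hSsymm hSgen a).antisymm
    (by simpa using wordLength_inv_le hSsymm hSgen a⁻¹)

theorem wordDist_mul_left (a x y : G) : wordDist S (a * x) (a * y) = wordDist S x y := by
  simp [wordDist, mul_assoc]

theorem wordDist_one_left (x : G) : wordDist S 1 x = wordLength S x := by
  simp [wordDist]

theorem wordDist_comm (hSsymm : ∀ s ∈ S, s⁻¹ ∈ S)
    (hSgen : Subgroup.closure S = ⊤) (x y : G) : wordDist S x y = wordDist S y x := by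
  rw [wordDist, ← wordLength_inv hSsymm hSgen]
  simp [wordDist]

theorem wordDist_triangle (hSsymm : ∀ s ∈ S, s⁻¹ ∈ S)
    (hSgen : Subgroup.closure S = ⊤) (x y z : G) :
    wordDist S x z ≤ wordDist S x y + wordDist S y z := by
  simpa [wordDist, mul_assoc] using wordLength_mul_le hSsymm hSgen (x⁻¹ * y) (y⁻¹ * z)

theorem IsWordGeodesic.wordDist_eq {N : ℕ} {γ : Fin (N + 1) → G} (h : IsWordGeodesic S N γ)
    {i j : Fin (N + 1)} (hij : i ≤ j) : wordDist S (γ i) (γ j) = (j : ℕ) - i := by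
  have h1 := h i j
  have h2 : (i : ℕ) ≤ j := hij
  rw [abs_of_nonpos (by omega)] at h1
  omega

theorem IsWordGeodesic.wordDist_add {N : ℕ} {γ : Fin (N + 1) → G} (h : IsWordGeodesic S N γ)
    (i : Fin (N + 1)) :
    wordDist S (γ 0) (γ i) + wordDist S (γ i) (γ (Fin.last N)) =
      wordDist S (γ 0) (γ (Fin.last N)) := by
  rw [h.wordDist_eq (Fin.zero_le i), h.wordDist_eq (Fin.le_last i),
    h.wordDist_eq (Fin.zero_le _)]
  have := i.is_le
  simp
  omega

theorem IsWordGeodesic.mul_left {N : ℕ} {γ : Fin (N + 1) → G} (h : IsWordGeodesic S N γ)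
    (a : G) : IsWordGeodesic S N (fun i => a * γ i) := fun i j => by
  rw [wordDist_mul_left, h i j]

theorem IsWordGeodesic.rev {N : ℕ} {γ : Fin (N + 1) → G} (h : IsWordGeodesic S N γ) :
    IsWordGeodesic S N (fun i => γ i.rev) := fun i j => by
  rw [h, abs_sub_comm]
  congr 1
  have := i.is_le
  have := j.is_le
  simp only [Fin.val_rev]
  omega

theorem exists_isWordGeodesic (hSsymm : ∀ s ∈ S, s⁻¹ ∈ S)
    (hSgen : Subgroup.closure S = ⊤) (x y : G) :
    ∃ (N : ℕ) (γ : Fin (N + 1) → G),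
      IsWordGeodesic S N γ ∧ γ 0 = x ∧ γ (Fin.last N) = y := by
  obtain ⟨l, hl, hlen, hprod⟩ := exists_list_length_eq_wordLength hSsymm hSgen (x⁻¹ * y)
  set γ : ℕ → G := fun i => x * (l.take i).prod with hγ
  have hγ0 : γ 0 = x := by simp [hγ]
  have hγN : γ l.length = y := by simp [hγ, hprod]
  have hle : ∀ i j : ℕ, i ≤ j → j ≤ l.length → wordDist S (γ i) (γ j) ≤ j - i := by
    intro i j hij hj
    have hsplit : (l.take j).prod = (l.take i).prod * ((l.take j).drop i).prod := by
      rw [← List.prod_take_mul_prod_drop (l.take j) i, List.take_take, min_eq_left hij]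
    have hd : wordDist S (γ i) (γ j) = wordLength S ((l.take j).drop i).prod := by
      simp only [hγ, wordDist_mul_left]
      rw [wordDist, hsplit, inv_mul_cancel_left]
    rw [hd]
    refine (wordLength_prod_le _ fun z hz => ?_).trans (by simp; omega)
    exact hl z (List.mem_of_mem_take (List.mem_of_mem_drop hz))
  have heq : ∀ i j : ℕ, i ≤ j → j ≤ l.length → wordDist S (γ i) (γ j) = j - i := by
    intro i j hij hj
    have h1 := hle i j hij hj
    have h2 := hle 0 i (by omega) (by omega)
    have h3 := hle j l.length hj le_rfl
    have h4 := wordDist_triangle hSsymm hSgen (γ 0) (γ i) (γ l.length)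
    have h5 := wordDist_triangle hSsymm hSgen (γ i) (γ j) (γ l.length)
    have h6 : wordDist S (γ 0) (γ l.length) = l.length := by rw [hγ0, hγN, hlen, wordDist]
    omega
  refine ⟨l.length, fun i => γ i, fun i j => ?_, by simpa using hγ0, by simpa using hγN⟩
  rcases le_total (i : ℕ) j with hij | hij
  · rw [heq i j hij j.is_le, abs_of_nonpos (by omega)]
    omega
  · rw [wordDist_comm hSsymm hSgen, heq j i hij i.is_le, abs_of_nonneg (by omega)]
    omega

/-- If `P` or `Q` holds at each `m ≤ T` and `Q` holds at `T`, then `Q` holds at `0` or there is a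
step at which `P` is followed by `Q`. -/
theorem Nat.exists_transition {P Q : ℕ → Prop} {T : ℕ} (hPQ : ∀ m ≤ T, P m ∨ Q m) (hT : Q T) :
    Q 0 ∨ ∃ m < T, P m ∧ Q (m + 1) := by
  classical
  have hex : ∃ m, Q m := ⟨T, hT⟩
  rcases hm : Nat.find hex with _ | m
  · exact Or.inl (hm ▸ Nat.find_spec hex)
  · have hle : m + 1 ≤ T := hm ▸ Nat.find_min' hex hT
    exact Or.inr ⟨m, hle, (hPQ m (by omega)).resolve_right (Nat.find_min hex (by omega)),
      hm ▸ Nat.find_spec hex⟩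

/-- A shortest conjugator `w` lies close to any geodesic from `1` to `r = w s w⁻¹`. -/
theorem exists_wordDist_conjugator_le (hSsymm : ∀ s ∈ S, s⁻¹ ∈ S)
    (hSgen : Subgroup.closure S = ⊤) {δ : ℝ} (hδ : 0 ≤ δ) (hhyp : WordSlimTriangles S δ)
    {K : ℝ} (hK : 1 ≤ K) (hcb : HasConjugacyBounds S K) {r s w : G} (hconj : r = w * s * w⁻¹)
    (hmin : ∀ v : G, r = v * s * v⁻¹ → wordLength S w ≤ wordLength S v)
    {N : ℕ} {γ : Fin (N + 1) → G} (hgeo : IsWordGeodesic S N γ)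
    (h0 : γ 0 = 1) (hN : γ (Fin.last N) = r) :
    ∃ i : Fin (N + 1),
      (wordDist S w (γ i) : ℝ) ≤ 2 * K * ((wordLength S s : ℝ) + 2 * δ) + 2 := by
  have tri : ∀ x y z : G, (wordDist S x z : ℝ) ≤ wordDist S x y + wordDist S y z :=
    fun x y z => mod_cast wordDist_triangle hSsymm hSgen x y z
  have comm : ∀ x y : G, (wordDist S x y : ℝ) = wordDist S y x :=
    fun x y => mod_cast wordDist_comm hSsymm hSgen x y
  have hrw : r * w = w * s := by rw [hconj]; group
  have hs0 : (0 : ℝ) ≤ wordLength S s := Nat.cast_nonneg _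
  have hws : (wordDist S w (w * s) : ℝ) = wordLength S s := by simp [wordDist]
  -- the geodesic triangle with vertices `w`, `1`, `r`
  obtain ⟨n, α, hα, hα0, hαn⟩ := exists_isWordGeodesic hSsymm hSgen w 1
  obtain ⟨T, τ, hτ, hτ0, hτT⟩ := exists_isWordGeodesic hSsymm hSgen w r
  have hslim := hhyp w 1 r n N T α γ τ hα hgeo hτ hα0 hαn h0 hN hτ0 hτT
  have htrans := Nat.exists_transition (T := T)
    (P := fun m => ∃ l, (wordDist S (τ (Fin.ofNat (T + 1) m)) (α l) : ℝ) ≤ δ)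
    (Q := fun m => ∃ i, (wordDist S (τ (Fin.ofNat (T + 1) m)) (γ i) : ℝ) ≤ δ)
    (fun m _ => by
      obtain ⟨p, hp | hp, hd⟩ := hslim (Fin.ofNat (T + 1) m)
      · obtain ⟨l, rfl⟩ := hp
        exact Or.inl ⟨l, hd⟩
      · obtain ⟨i, rfl⟩ := hp
        exact Or.inr ⟨i, hd⟩)
    ⟨Fin.last N, by
      have : Fin.ofNat (T + 1) T = Fin.last T := by ext; simp
      rw [this, hτT, hN]
      simpa [wordDist, wordLength_one] using hδ⟩
  rcases htrans with ⟨i, hi⟩ | ⟨m, hmT, ⟨l, hl⟩, i, hi⟩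
  · refine ⟨i, ?_⟩
    have : Fin.ofNat (T + 1) 0 = 0 := by ext; simp
    rw [this, hτ0] at hi
    nlinarith
  refine ⟨i, ?_⟩
  set y := τ (Fin.ofNat (T + 1) m) with hy
  set y' := τ (Fin.ofNat (T + 1) (m + 1)) with hy'
  have hwy : (wordDist S w y : ℝ) = m := by
    rw [hy, ← hτ0, hτ.wordDist_eq (Fin.zero_le _)]
    simp [Nat.mod_eq_of_lt (by omega : m < T + 1)]
  have hwy' : (wordDist S w y' : ℝ) = m + 1 := by
    rw [hy', ← hτ0, hτ.wordDist_eq (Fin.zero_le _)]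
    simp [Nat.mod_eq_of_lt (by omega : m + 1 < T + 1)]
  have hyr : (wordDist S w y : ℝ) + wordDist S y r = wordDist S w r := by
    have := hτ.wordDist_add (Fin.ofNat (T + 1) m)
    rw [hτ0, hτT] at this
    exact_mod_cast this
  set x := α l with hx
  have hwx : (wordDist S w x : ℝ) + wordDist S x 1 = wordDist S w 1 := by
    have := hα.wordDist_add l
    rw [hα0, hαn] at this
    exact_mod_cast this
  have hlen : ∀ g : G, (wordDist S g 1 : ℝ) = wordLength S g := fun g => by
    rw [comm, wordDist_one_left]
  have hwr : (wordDist S (w * s) r : ℝ) = wordLength S w := by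
    rw [← hlen w, ← wordDist_mul_left r w 1, hrw, mul_one]
  -- the displacement of `x` under `r`
  have hD : (wordDist S x (r * x) : ℝ) ≤
        3 * δ + wordLength S s + wordDist S w x - m ∨
      (wordDist S x (r * x) : ℝ) ≤ 2 * δ + wordLength S s := by
    obtain ⟨N₁, σ₁, hσ₁, hσ₁0, hσ₁N⟩ := exists_isWordGeodesic hSsymm hSgen (w * s) x
    obtain ⟨N₂, σ₂, hσ₂, hσ₂0, hσ₂N⟩ := exists_isWordGeodesic hSsymm hSgen x r
    obtain ⟨q, hq | hq, hd⟩ := hhyp (w * s) x r N₁ N₂ n σ₁ σ₂ (fun i => r * α i) hσ₁ hσ₂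
      (hα.mul_left r) hσ₁0 hσ₁N hσ₂0 hσ₂N (by simp [hα0, hrw]) (by simp [hαn]) l
    all_goals
      obtain ⟨k, rfl⟩ := hq
      simp only [← hx] at hd
    · right
      have h1 : (wordDist S (w * s) (σ₁ k) : ℝ) + wordDist S (σ₁ k) x =
          wordDist S (w * s) x := by
        have := hσ₁.wordDist_add k
        rw [hσ₁0, hσ₁N] at this
        exact_mod_cast this
      have h2 : (wordDist S (w * s) (r * x) : ℝ) = wordDist S w x := by
        rw [← hrw, wordDist_mul_left]
      linarith [tri x (σ₁ k) (r * x), tri (w * s) (σ₁ k) (r * x), tri (w * s) w x,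
        comm (σ₁ k) (r * x), comm x (σ₁ k), comm (w * s) w]
    · left
      have h1 : (wordDist S x (σ₂ k) : ℝ) + wordDist S (σ₂ k) r = wordDist S x r := by
        have := hσ₂.wordDist_add k
        rw [hσ₂0, hσ₂N] at this
        exact_mod_cast this
      have h2 : (wordDist S (r * x) r : ℝ) = wordDist S x 1 := by
        rw [← wordDist_mul_left r x 1, mul_one]
      linarith [tri x (σ₂ k) (r * x), tri (r * x) (σ₂ k) r, tri x y r, tri w (w * s) r,
        comm (σ₂ k) (r * x), comm x y, hlen w]
  -- the conjugacy bound at `x`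
  obtain ⟨v, hv, hvlen⟩ := hcb (x⁻¹ * (r * x)) s
    (isConj_iff.2 ⟨w⁻¹ * x, by rw [hconj]; group⟩ : IsConj _ _)
  have hminx : (wordLength S w : ℝ) ≤ wordLength S x + wordLength S v := by
    have h1 := hmin (x * v) (by
      have : r = x * (x⁻¹ * (r * x)) * x⁻¹ := by group
      rw [this, hv]; group)
    exact_mod_cast h1.trans (wordLength_mul_le hSsymm hSgen x v)
  change _ ≤ K * ((wordDist S x (r * x) : ℝ) + _) at hvlen
  have ht : (wordDist S w x : ℝ) ≤ K * (wordDist S x (r * x) + wordLength S s) := by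
    linarith [hlen w, hlen x]
  have hgoal : (wordDist S w (γ i) : ℝ) ≤ m + 1 + δ := by linarith [tri w y' (γ i)]
  have he₁ : (wordDist S w x : ℝ) - m ≤ δ := by linarith [tri w y x]
  have he₂ : (m : ℝ) - wordDist S w x ≤ δ := by linarith [tri w x y, comm x y]
  rcases hD with hD | hD
  · have := mul_le_mul_of_nonneg_left hD (by linarith : 0 ≤ K)
    nlinarith [mul_nonneg (sub_nonneg.2 hK) (sub_nonneg.2 he₁)]
  · have := mul_le_mul_of_nonneg_left hD (by linarith : 0 ≤ K)
    nlinarith [mul_nonneg (sub_nonneg.2 hK) hδ]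

end WordMetric

/-- Suppose the word metric of a symmetric generating set `S` on `G` is `δ`-hyperbolic and
`G` has conjugacy bounds with constant `K ≥ 1`.  If `r = w s w⁻¹` with `w` of minimal word
length among elements conjugating `s` to `r`, then for every geodesic
`γ 0 = 1, …, γ N = r` from the identity to `r`, both `w` and `ws` lie within distance
`L₁ = 2K(∥s∥ + 2δ) + 2` of the set `{γ 0, …, γ N}`; in particular the path corresponding
to the word `w s w⁻¹` lies in a neighbourhood of any geodesic from `1` to `r` whose radius
depends only on `∥s∥`, `δ` and `K`, and not on `∥r∥`. -/
theorem statement3 {G : Type*} [Group G]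
    (S : Set G) (hSsymm : ∀ s ∈ S, s⁻¹ ∈ S) (hSgen : Subgroup.closure S = ⊤)
    (δ : ℝ) (hδ : 0 ≤ δ) (hhyp : WordSlimTriangles S δ)
    (K : ℝ) (hK : 1 ≤ K) (hcb : HasConjugacyBounds S K)
    (r s w : G) (hconj : r = w * s * w⁻¹)
    (hmin : ∀ v : G, r = v * s * v⁻¹ → wordLength S w ≤ wordLength S v)
    (N : ℕ) (γ : Fin (N + 1) → G) (hgeo : IsWordGeodesic S N γ)
    (h0 : γ 0 = 1) (hN : γ (Fin.last N) = r) :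
    (∃ i : Fin (N + 1),
        (wordDist S w (γ i) : ℝ) ≤ 2 * K * ((wordLength S s : ℝ) + 2 * δ) + 2) ∧
      (∃ i : Fin (N + 1),
        (wordDist S (w * s) (γ i) : ℝ) ≤ 2 * K * ((wordLength S s : ℝ) + 2 * δ) + 2) := by
  refine ⟨exists_wordDist_conjugator_le hSsymm hSgen hδ hhyp hK hcb hconj hmin hgeo h0 hN, ?_⟩
  have hrw : r * w = w * s := by rw [hconj]; group
  obtain ⟨i, hi⟩ := exists_wordDist_conjugator_le hSsymm hSgen hδ hhyp hK hcb
    (r := r⁻¹) (s := s⁻¹) (w := w) (by rw [hconj]; group)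
    (fun v hv => hmin v (by rw [← inv_inv r, hv]; group))
    (hgeo.rev.mul_left r⁻¹) (by simp [hN]) (by simp [h0])
  refine ⟨i.rev, ?_⟩
  rwa [wordLength_inv hSsymm hSgen, ← wordDist_mul_left r, hrw, mul_inv_cancel_left] at hi
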